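/- The spinor space S is spanned by its pure spinors: every element of S is a finite linear combination of pure spinors. -/

import Mathlib

noncomputable section

open scoped TensorProduct

/-- The `(2m+1)`-dimensional space `V := N × N* × ℂ`. -/
abbrev Vsp (N : Type) [AddCommGroup N] [Module ℂ N] : Type := N × (N →ₗ[ℂ] ℂ) × ℂ

/-- The bilinear map `B((v,φ,t),(v',φ',t')) = φ(v') − t·t'`, whose diagonal is `Q`. -/
def Bform (N : Type) [AddCommGroup N] [Module ℂ N] : Vsp N →ₗ[ℂ] Vsp N →ₗ[ℂ] ℂ :=
  LinearMap.mk₂ ℂ (fun x y => x.2.1 y.1 - x.2.2 * y.2.2)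
    (fun x x' y => by simp only [Prod.fst_add, Prod.snd_add, LinearMap.add_apply]; ring)
    (fun c x y => by
      simp only [Prod.smul_fst, Prod.smul_snd, LinearMap.smul_apply, smul_eq_mul]; ring)
    (fun x y y' => by simp only [Prod.fst_add, Prod.snd_add, map_add]; ring)
    (fun c x y => by simp only [Prod.smul_fst, Prod.smul_snd, map_smul, smul_eq_mul]; ring)

/-- The quadratic form `Q(v, φ, t) := φ(v) − t²`. -/
def Qform (N : Type) [AddCommGroup N] [Module ℂ N] : QuadraticForm ℂ (Vsp N) :=
  LinearMap.BilinMap.toQuadraticMap (Bform N)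

/-- The polar form `g(x,y) := (Q(x+y) − Q(x) − Q(y))/2`. -/
def gform (N : Type) [AddCommGroup N] [Module ℂ N] (x y : Vsp N) : ℂ :=
  (Qform N (x + y) - Qform N x - Qform N y) / 2

/-- `σ` : the involution acting on `⋀^k N` as `(−1)^(m−k)`. -/
def sigmaMap (m : ℕ) (N : Type) [AddCommGroup N] [Module ℂ N] :
    ExteriorAlgebra ℂ N →ₗ[ℂ] ExteriorAlgebra ℂ N :=
  ((-1 : ℂ) ^ m) • (CliffordAlgebra.involute (Q := (0 : QuadraticForm ℂ N))).toLinearMap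

/-- `ρ(v, φ, t)(ξ) := v ∧ ξ − ι_φ(ξ) + t·σ(ξ)`. -/
def rho (m : ℕ) (N : Type) [AddCommGroup N] [Module ℂ N] :
    Vsp N →ₗ[ℂ] ExteriorAlgebra ℂ N →ₗ[ℂ] ExteriorAlgebra ℂ N :=
  (LinearMap.mul ℂ (ExteriorAlgebra ℂ N) ∘ₗ ExteriorAlgebra.ι ℂ ∘ₗ
      LinearMap.fst ℂ N ((N →ₗ[ℂ] ℂ) × ℂ))
  - (CliffordAlgebra.contractLeft (Q := (0 : QuadraticForm ℂ N)) ∘ₗ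
      LinearMap.fst ℂ (N →ₗ[ℂ] ℂ) ℂ ∘ₗ LinearMap.snd ℂ N ((N →ₗ[ℂ] ℂ) × ℂ))
  + (LinearMap.toSpanSingleton ℂ (ExteriorAlgebra ℂ N →ₗ[ℂ] ExteriorAlgebra ℂ N)
        (sigmaMap m N) ∘ₗ
      LinearMap.snd ℂ (N →ₗ[ℂ] ℂ) ℂ ∘ₗ LinearMap.snd ℂ N ((N →ₗ[ℂ] ℂ) × ℂ))

/-- `K_ξ := {x ∈ V : ρ(x)(ξ) = 0}`. -/
def Kker (m : ℕ) (N : Type) [AddCommGroup N] [Module ℂ N] (ξ : ExteriorAlgebra ℂ N) :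
    Submodule ℂ (Vsp N) :=
  LinearMap.ker ((rho m N).flip ξ)

section PureSpinors

variable {N : Type} [AddCommGroup N] [Module ℂ N]

open CliffordAlgebra in
/-- Contraction anticommutes with the grade involution. -/
theorem contractLeft_involute (d : Module.Dual ℂ N) (ξ : ExteriorAlgebra ℂ N) :
    contractLeft (Q := (0 : QuadraticForm ℂ N)) d (involute (Q := (0 : QuadraticForm ℂ N)) ξ) =
      -involute (Q := (0 : QuadraticForm ℂ N))
        (contractLeft (Q := (0 : QuadraticForm ℂ N)) d ξ) := by
  induction ξ using CliffordAlgebra.left_induction with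
  | algebraMap r => simp
  | add x y hx hy => simp only [map_add, hx, hy, neg_add]
  | ι_mul x m hx =>
    simp only [map_mul, involute_ι, neg_mul, map_neg, contractLeft_ι_mul, hx, map_sub, map_smul,
      mul_neg]

theorem rho_apply (m : ℕ) (x : Vsp N) (ξ : ExteriorAlgebra ℂ N) :
    rho m N x ξ = ExteriorAlgebra.ι ℂ x.1 * ξ
      - CliffordAlgebra.contractLeft (Q := (0 : QuadraticForm ℂ N)) x.2.1 ξ
      + x.2.2 • ((-1 : ℂ) ^ m •
        CliffordAlgebra.involute (Q := (0 : QuadraticForm ℂ N)) ξ) := rfl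

theorem mem_Kker (m : ℕ) (x : Vsp N) (ξ : ExteriorAlgebra ℂ N) :
    x ∈ Kker m N ξ ↔ rho m N x ξ = 0 := Iff.rfl

/-- The Clifford relation `ρ(x)² = -Q(x)`. -/
theorem rho_rho_self (m : ℕ) (x : Vsp N) (ξ : ExteriorAlgebra ℂ N) :
    rho m N x (rho m N x ξ) = (x.2.2 ^ 2 - x.2.1 x.1) • ξ := by
  obtain ⟨v, φ, t⟩ := x
  have hvv : ExteriorAlgebra.ι ℂ v * (ExteriorAlgebra.ι ℂ v * ξ) = 0 := by
    rw [← mul_assoc, ExteriorAlgebra.ι_sq_zero, zero_mul]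
  have hiv (η : ExteriorAlgebra ℂ N) :
      CliffordAlgebra.contractLeft (Q := (0 : QuadraticForm ℂ N)) φ (ExteriorAlgebra.ι ℂ v * η) =
        φ v • η - ExteriorAlgebra.ι ℂ v *
          CliffordAlgebra.contractLeft (Q := (0 : QuadraticForm ℂ N)) φ η :=
    CliffordAlgebra.contractLeft_ι_mul φ v η
  have hsv (η : ExteriorAlgebra ℂ N) :
      CliffordAlgebra.involute (Q := (0 : QuadraticForm ℂ N)) (ExteriorAlgebra.ι ℂ v * η) =
        -(ExteriorAlgebra.ι ℂ v *
          CliffordAlgebra.involute (Q := (0 : QuadraticForm ℂ N)) η) := by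
    rw [map_mul, ← neg_mul]
    exact congrArg (· * _) (CliffordAlgebra.involute_ι v)
  have hsign : ((-1 : ℂ) ^ m) * (-1) ^ m = 1 := by
    rw [← mul_pow]; norm_num
  simp only [rho_apply, map_add, map_sub, map_smul, hvv, hiv, hsv,
    contractLeft_involute, CliffordAlgebra.contractLeft_contractLeft,
    CliffordAlgebra.involute_involute]
  linear_combination (norm := module) (t ^ 2 * hsign) • ξ

/-- `K_ξ` is totally isotropic when `ξ ≠ 0`. -/
theorem quadratic_eq_zero_of_mem_Kker {m : ℕ} {x : Vsp N} {ξ : ExteriorAlgebra ℂ N}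
    (hξ : ξ ≠ 0) (hx : x ∈ Kker m N ξ) : x.2.2 ^ 2 - x.2.1 x.1 = 0 := by
  have h := rho_rho_self m x ξ
  rw [(mem_Kker m x ξ).1 hx, map_zero] at h
  exact (smul_eq_zero.1 h.symm).resolve_right hξ

variable {κ : Type*} (b : Module.Basis κ ℂ N)

/-- The wedge product of the basis vectors indexed by a list. -/
def wedgeList (l : List κ) : ExteriorAlgebra ℂ N :=
  (l.map fun i => ExteriorAlgebra.ι ℂ (b i)).prod

theorem wedgeList_cons (i : κ) (l : List κ) :
    wedgeList b (i :: l) = ExteriorAlgebra.ι ℂ (b i) * wedgeList b l := by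
  simp [wedgeList]

theorem ι_mul_mem_span_wedgeList (v : N) {ξ : ExteriorAlgebra ℂ N}
    (hξ : ξ ∈ Submodule.span ℂ (Set.range (wedgeList b))) :
    ExteriorAlgebra.ι ℂ v * ξ ∈ Submodule.span ℂ (Set.range (wedgeList b)) := by
  induction b.mem_span v using Submodule.span_induction with
  | zero => simp
  | add v w _ _ hv hw =>
    rw [map_add, add_mul]
    exact Submodule.add_mem _ hv hw
  | smul c v _ hv =>
    rw [map_smul, smul_mul_assoc]
    exact Submodule.smul_mem _ _ hv
  | mem v hv =>
    obtain ⟨i, rfl⟩ := hv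
    induction hξ using Submodule.span_induction with
    | zero => simp
    | add ξ η _ _ hξ hη =>
      rw [mul_add]
      exact Submodule.add_mem _ hξ hη
    | smul c ξ _ hξ =>
      rw [mul_smul_comm]
      exact Submodule.smul_mem _ _ hξ
    | mem ξ hξ =>
      obtain ⟨l, rfl⟩ := hξ
      exact Submodule.subset_span ⟨i :: l, wedgeList_cons b i l⟩

theorem span_range_wedgeList : Submodule.span ℂ (Set.range (wedgeList b)) = ⊤ := by
  refine Submodule.eq_top_iff'.2 fun ξ => ?_
  induction ξ using CliffordAlgebra.left_induction with
  | algebraMap r =>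
    rw [Algebra.algebraMap_eq_smul_one]
    exact Submodule.smul_mem _ _ (Submodule.subset_span ⟨[], by simp [wedgeList]⟩)
  | add x y hx hy => exact Submodule.add_mem _ hx hy
  | ι_mul x v hx => exact ι_mul_mem_span_wedgeList b v hx

theorem ι_mul_wedgeList {i : κ} {l : List κ} (hi : i ∈ l) :
    ExteriorAlgebra.ι ℂ (b i) * wedgeList b l = 0 := by
  induction l with
  | nil => simp at hi
  | cons j l ih =>
    rw [wedgeList_cons]
    rcases List.mem_cons.1 hi with rfl | hi
    · rw [← mul_assoc, ExteriorAlgebra.ι_sq_zero, zero_mul]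
    · rw [← mul_assoc, eq_neg_of_add_eq_zero_left (ExteriorAlgebra.ι_add_mul_swap (b i) (b j)),
        neg_mul, mul_assoc, ih hi, mul_zero, neg_zero]

theorem contractLeft_wedgeList {d : Module.Dual ℂ N} {l : List κ} (hd : ∀ i ∈ l, d (b i) = 0) :
    CliffordAlgebra.contractLeft (Q := (0 : QuadraticForm ℂ N)) d (wedgeList b l) = 0 := by
  induction l with
  | nil => exact CliffordAlgebra.contractLeft_one _ _
  | cons j l ih =>
    rw [wedgeList_cons]
    refine (CliffordAlgebra.contractLeft_ι_mul d (b j) (wedgeList b l)).trans ?_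
    rw [hd j (by simp), ih fun i hi => hd i (List.mem_cons_of_mem _ hi)]
    simp

open Classical in
/-- The basis of `K_ξ`, for `ξ` a wedge product of basis vectors. -/
def kerVector (l : List κ) (i : κ) : Vsp N :=
  if i ∈ l then (b i, 0, 0) else (0, b.coord i, 0)

theorem kerVector_mem_Kker (m : ℕ) (l : List κ) (i : κ) :
    kerVector b l i ∈ Kker m N (wedgeList b l) := by
  rw [mem_Kker, rho_apply, kerVector]
  split_ifs with hi
  · simp [ι_mul_wedgeList b hi]
  · rw [contractLeft_wedgeList b (d := b.coord i)]
    · simp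
    · intro j hj
      rw [b.coord_apply, b.repr_self, Finsupp.single_eq_of_ne]
      rintro rfl
      exact hi hj

theorem linearIndependent_kerVector [Fintype κ] (l : List κ) :
    LinearIndependent ℂ (kerVector b l) := by
  classical
  rw [Fintype.linearIndependent_iff]
  intro c hc i
  by_cases hi : i ∈ l
  · have h := congrArg (fun x : Vsp N => b.coord i x.1) hc
    simp only [Prod.fst_sum, map_sum] at h
    rw [Finset.sum_eq_single i] at h
    · simpa [kerVector, hi] using h
    · intro j _ hj
      by_cases hjl : j ∈ l <;> simp [kerVector, hjl, hj]
    · simp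
  · have h := congrArg (fun x : Vsp N => x.2.1 (b i)) hc
    simp only [Prod.snd_sum, Prod.fst_sum, LinearMap.sum_apply] at h
    rw [Finset.sum_eq_single i] at h
    · simpa [kerVector, hi] using h
    · intro j _ hj
      by_cases hjl : j ∈ l <;> simp [kerVector, hjl, hj.symm]
    · simp

theorem Kker_wedgeList [Fintype κ] (m : ℕ) {l : List κ} (hl : wedgeList b l ≠ 0) :
    Kker m N (wedgeList b l) = Submodule.span ℂ (Set.range (kerVector b l)) := by
  classical
  apply le_antisymm
  · rintro ⟨v, φ, t⟩ hx
    have hQ := quadratic_eq_zero_of_mem_Kker hl hx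
    have hpair (i : κ) := quadratic_eq_zero_of_mem_Kker hl
      (Submodule.add_mem _ hx (kerVector_mem_Kker b m l i))
    have hφ (i : κ) (hi : i ∈ l) : φ (b i) = 0 := by
      have h := hpair i
      simp [kerVector, hi] at h hQ
      linear_combination hQ - h
    have hv (i : κ) (hi : i ∉ l) : b.repr v i = 0 := by
      have h := hpair i
      simp [kerVector, hi] at h hQ
      linear_combination hQ - h
    have hφv : φ v = 0 := by
      rw [← b.sum_repr v, map_sum]
      refine Finset.sum_eq_zero fun i _ => ?_
      by_cases hi : i ∈ l
      · simp [hφ i hi]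
      · simp [hv i hi]
    have ht : t = 0 := by simpa [hφv] using hQ
    have hsum : ((v, φ, t) : Vsp N) =
        ∑ i, (if i ∈ l then b.repr v i else φ (b i)) • kerVector b l i := by
      refine Prod.ext ?_ (Prod.ext ?_ ?_)
      · rw [Prod.fst_sum]
        refine (b.sum_repr v).symm.trans (Finset.sum_congr rfl fun i _ => ?_)
        by_cases hi : i ∈ l
        · simp [kerVector, hi]
        · simp [kerVector, hi, hv i hi]
      · rw [Prod.snd_sum, Prod.fst_sum]
        refine b.ext fun j => ?_
        rw [LinearMap.sum_apply, Finset.sum_eq_single j]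
        · by_cases hj : j ∈ l <;> simp [kerVector, hj, hφ]
        · intro i _ hi
          by_cases hil : i ∈ l <;> simp [kerVector, hil, hi.symm]
        · simp
      · rw [Prod.snd_sum, Prod.snd_sum]
        refine ht.trans (Finset.sum_eq_zero fun i _ => ?_).symm
        by_cases hi : i ∈ l <;> simp [kerVector, hi]
    rw [hsum]
    exact Submodule.sum_mem _ fun i _ =>
      Submodule.smul_mem _ _ (Submodule.subset_span (Set.mem_range_self i))
  · rw [Submodule.span_le]
    rintro _ ⟨i, rfl⟩
    exact kerVector_mem_Kker b m l i

end PureSpinors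

/-- the spinor space `S` is spanned by its pure spinors. -/
theorem span_of_pure_spinors
    (m : ℕ) (hm : 0 < m) (N : Type) [AddCommGroup N] [Module ℂ N]
    [FiniteDimensional ℂ N] (hdim : Module.finrank ℂ N = m) :
    Submodule.span ℂ
        {ξ : ExteriorAlgebra ℂ N | ξ ≠ 0 ∧ Module.finrank ℂ (Kker m N ξ) = m} = ⊤ := by
  let b := Module.finBasis ℂ N
  rw [eq_top_iff, ← span_range_wedgeList b, Submodule.span_le]
  rintro _ ⟨l, rfl⟩
  by_cases hl : wedgeList b l = 0
  · rw [hl]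
    exact Submodule.zero_mem _
  · refine Submodule.subset_span ⟨hl, ?_⟩
    rw [Kker_wedgeList b m hl, finrank_span_eq_card (linearIndependent_kerVector b l),
      Fintype.card_fin, hdim]
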